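/- arXiv:2301.02205 — 2 statements merged into one kernel-verified Lean document; each statement's English description precedes it below -/
import Mathlib

section
/- Let S be a meet-semilattice with least element 0 satisfying the ascending chain condition and let N be a map assigning to each x ∈ S a subset N(x) ⊆ S. Then the following are equivalent: (i) N(x) = Max{y ∈ S | x ∧ y = 0} for all x ∈ S; (ii) N satisfies for all x, y ∈ S: (P1) N(x) is an antichain, (P2) x ∧ N(0) ≈₁ {x}, (P3) every element of x ∧ N(x) equals 0, (P4) x ∧ N(x ∧ y) ≈₁ x ∧ N(y). -/
/-- The set of maximal elements of `A`. -/
def MaxSet {S : Type*} [PartialOrder S] (A : Set S) : Set S :=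
  {m | m ∈ A ∧ ∀ x ∈ A, m ≤ x → x = m}

/-- The ascending chain condition, stated as: every nonempty subset has a maximal element. -/
def AccMax (S : Type*) [PartialOrder S] : Prop :=
  ∀ A : Set S, A.Nonempty → (MaxSet A).Nonempty

/-- Unsharp negation: `a⁰ = Max {x | a ⊓ x = ⊥}`. -/
def UNeg {S : Type*} [SemilatticeInf S] [OrderBot S] (a : S) : Set S :=
  MaxSet {x | a ⊓ x = ⊥}

/-- Unsharp implication: `a → b = Max {x | a ⊓ x ≤ b}`. -/
def UImp {S : Type*} [SemilatticeInf S] (a b : S) : Set S :=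
  MaxSet {x | a ⊓ x ≤ b}

/-- `A ≤₁ B` : every element of `A` lies below some element of `B`. -/
def Le1 {S : Type*} [Preorder S] (A B : Set S) : Prop :=
  ∀ a ∈ A, ∃ b ∈ B, a ≤ b

/-- `A ≈₁ B` : `A ≤₁ B` and `B ≤₁ A`. -/
def Approx1 {S : Type*} [Preorder S] (A B : Set S) : Prop :=
  Le1 A B ∧ Le1 B A

/-- Elementwise meet of two sets: `A ∧ B = {a ⊓ b | a ∈ A, b ∈ B}`. -/
def MeetSet {S : Type*} [SemilatticeInf S] (A B : Set S) : Set S :=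
  {c | ∃ a ∈ A, ∃ b ∈ B, c = a ⊓ b}

/-- Under the ascending chain condition, every element of a set lies below a maximal one. -/
theorem AccMax.exists_le_mem_maxSet {S : Type*} [PartialOrder S] (hacc : AccMax S)
    {A : Set S} {y : S} (hy : y ∈ A) : ∃ z ∈ MaxSet A, y ≤ z := by
  obtain ⟨z, ⟨hzA, hyz⟩, hz⟩ := hacc {w | w ∈ A ∧ y ≤ w} ⟨y, hy, le_rfl⟩
  exact ⟨z, ⟨hzA, fun x hx hzx => hz x ⟨hx, hyz.trans hzx⟩ hzx⟩, hyz⟩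

/-- The set of maximal elements is an antichain. -/
theorem isAntichain_maxSet {S : Type*} [PartialOrder S] (A : Set S) :
    IsAntichain (· ≤ ·) (MaxSet A) :=
  fun _ ha b hb hne hab => hne (ha.2 b hb.1 hab).symm

/-- An antichain contained in `A` and cofinal in `A` is the set of maximal elements of `A`. -/
theorem IsAntichain.eq_maxSet {S : Type*} [PartialOrder S] {A B : Set S}
    (hB : IsAntichain (· ≤ ·) B) (hBA : B ⊆ A) (hAB : Le1 A B) : B = MaxSet A := by
  ext m
  constructor
  · refine fun hm => ⟨hBA hm, fun x hx hmx => ?_⟩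
    obtain ⟨b, hb, hxb⟩ := hAB x hx
    have hmb : m = b := hB.eq hm hb (hmx.trans hxb)
    exact le_antisymm (hxb.trans hmb.ge) hmx
  · rintro ⟨hmA, hm⟩
    obtain ⟨b, hb, hmb⟩ := hAB m hmA
    exact hm b (hBA hb) hmb ▸ hb

/-- Meeting with `x` preserves `≤₁` as soon as each `x ⊓ a` lies below an element of `B`. -/
theorem le1_meetSet_singleton {S : Type*} [SemilatticeInf S] {x : S} {A B : Set S}
    (h : ∀ a ∈ A, ∃ b ∈ B, x ⊓ a ≤ b) : Le1 (MeetSet {x} A) (MeetSet {x} B) := by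
  rintro _ ⟨_, rfl, a, ha, rfl⟩
  obtain ⟨b, hb, hab⟩ := h a ha
  exact ⟨_, ⟨_, rfl, b, hb, rfl⟩, le_inf inf_le_left hab⟩

theorem stmt8 {S : Type*} [SemilatticeInf S] [OrderBot S] (hacc : AccMax S)
    (N : S → Set S) :
    (∀ x : S, N x = UNeg x) ↔
      ((∀ x : S, IsAntichain (· ≤ ·) (N x)) ∧
       (∀ x : S, Approx1 (MeetSet {x} (N ⊥)) {x}) ∧
       (∀ x : S, ∀ z ∈ N x, x ⊓ z = ⊥) ∧
       (∀ x y : S, Approx1 (MeetSet {x} (N (x ⊓ y))) (MeetSet {x} (N y)))) := by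
  constructor
  · intro h
    obtain rfl : N = UNeg := funext h
    have exists_le {a y : S} (hy : a ⊓ y = ⊥) : ∃ z ∈ UNeg a, y ≤ z :=
      hacc.exists_le_mem_maxSet (A := {x | a ⊓ x = ⊥}) hy
    have inf_eq {a z : S} (hz : z ∈ UNeg a) : a ⊓ z = ⊥ := hz.1
    refine ⟨fun x => isAntichain_maxSet _, fun x => ⟨?_, ?_⟩, fun x z => inf_eq, fun x y =>
      ⟨le1_meetSet_singleton fun z hz => exists_le ?_, le1_meetSet_singleton fun z hz => ?_⟩⟩
    · rintro _ ⟨_, rfl, b, -, rfl⟩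
      exact ⟨_, rfl, inf_le_left⟩
    · intro y hy
      obtain rfl : y = x := hy
      obtain ⟨b, hb, hyb⟩ := exists_le (bot_inf_eq y)
      exact ⟨_, ⟨_, rfl, b, hb, rfl⟩, le_inf le_rfl hyb⟩
    · rw [← inf_assoc, inf_comm y x, inf_eq hz]
    · obtain ⟨w, hw, hzw⟩ := exists_le (a := x ⊓ y) (y := z) (by
        rw [inf_assoc, inf_eq hz, inf_bot_eq])
      exact ⟨w, hw, inf_le_right.trans hzw⟩
  · rintro ⟨hanti, hbot, hinf, hmeet⟩ x
    refine (hanti x).eq_maxSet (hinf x) fun y hy => ?_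
    have hyx : y ⊓ x = ⊥ := (inf_comm y x).trans hy
    obtain ⟨c, hc, hyc⟩ := (hbot y).2 y rfl
    obtain ⟨_, ⟨_, rfl, z, hz, rfl⟩, hcz⟩ := (hmeet y x).1 c (hyx.symm ▸ hc)
    exact ⟨z, hz, hyc.trans (hcz.trans inf_le_right)⟩
end

section
/- Let S be a meet-semilattice with least element 0 satisfying the ascending chain condition and let R be a map assigning to each pair (x, y) ∈ S × S a subset R(x, y) ⊆ S. Then the following are equivalent: (i) R(x, y) = Max{z ∈ S | x ∧ z ≤ y} for all x, y ∈ S; (ii) R satisfies for all x, y, z ∈ S: (R1) R(x, y) is an antichain, (R2) x ∧ R(x, y) ≈₁ {x ∧ y}, (R3) R(x, y) ∧ y ≈₁ {y}, (R4) R(x, y ∧ z) ≈₁ R(x, y) ∧ R(x, z), (R5) x ∧ R(y, y) ≈₁ {x}, (R6) y ≤ z implies R(x, y) ≤₁ R(x, z). -/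
/-- Under the ascending chain condition every element of a set lies below a maximal one. -/
theorem AccMax.exists_le_maxSet {S : Type*} [PartialOrder S] (hacc : AccMax S) {A : Set S}
    {a : S} (ha : a ∈ A) : ∃ m ∈ MaxSet A, a ≤ m := by
  obtain ⟨m, ⟨hmA, ham⟩, hm⟩ := hacc {x | x ∈ A ∧ a ≤ x} ⟨a, ha, le_rfl⟩
  exact ⟨m, ⟨hmA, fun x hx hmx => hm x ⟨hx, ham.trans hmx⟩ hmx⟩, ham⟩

/-- An antichain is the set of maximal elements of its lower closure. -/
theorem IsAntichain.eq_maxSet_s18 {S : Type*} [PartialOrder S] {A D : Set S}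
    (hA : IsAntichain (· ≤ ·) A) (hD : ∀ z, z ∈ D ↔ ∃ a ∈ A, z ≤ a) : A = MaxSet D := by
  ext m
  constructor
  · intro hm
    refine ⟨(hD m).2 ⟨m, hm, le_rfl⟩, fun x hx hmx => ?_⟩
    obtain ⟨a, ha, hxa⟩ := (hD x).1 hx
    exact le_antisymm (hxa.trans (hA.eq hm ha (hmx.trans hxa)).ge) hmx
  · rintro ⟨hmD, hmax⟩
    obtain ⟨a, ha, hma⟩ := (hD m).1 hmD
    exact hmax a ((hD a).2 ⟨a, ha, le_rfl⟩) hma ▸ ha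

theorem inf_le_of_mem_uImp {S : Type*} [SemilatticeInf S] {x y u : S} (hu : u ∈ UImp x y) :
    x ⊓ u ≤ y :=
  hu.1

theorem AccMax.exists_le_uImp {S : Type*} [SemilatticeInf S] (hacc : AccMax S) {x y z : S}
    (h : x ⊓ z ≤ y) : ∃ u ∈ UImp x y, z ≤ u :=
  hacc.exists_le_maxSet (A := {w | x ⊓ w ≤ y}) h

theorem stmt18 {S : Type*} [SemilatticeInf S] [OrderBot S] (hacc : AccMax S)
    (R : S → S → Set S) :
    (∀ x y : S, R x y = UImp x y) ↔
      ((∀ x y : S, IsAntichain (· ≤ ·) (R x y)) ∧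
       (∀ x y : S, Approx1 (MeetSet {x} (R x y)) {x ⊓ y}) ∧
       (∀ x y : S, Approx1 (MeetSet (R x y) {y}) {y}) ∧
       (∀ x y z : S, Approx1 (R x (y ⊓ z)) (MeetSet (R x y) (R x z))) ∧
       (∀ x y : S, Approx1 (MeetSet {x} (R y y)) {x}) ∧
       (∀ x y z : S, y ≤ z → Le1 (R x y) (R x z))) := by
  constructor
  · intro hR
    simp only [hR]
    refine ⟨fun x y => isAntichain_maxSet _, fun x y => ⟨?_, ?_⟩, fun x y => ⟨?_, ?_⟩,
      fun x y z => ⟨?_, ?_⟩, fun x y => ⟨?_, ?_⟩, fun x y z hyz u hu => ?_⟩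
    · rintro _ ⟨_, rfl, u, hu, rfl⟩
      exact ⟨_, rfl, le_inf inf_le_left (inf_le_of_mem_uImp hu)⟩
    · rintro _ rfl
      obtain ⟨u, hu, hyu⟩ := hacc.exists_le_uImp (inf_le_right : x ⊓ y ≤ y)
      exact ⟨_, ⟨x, rfl, u, hu, rfl⟩, inf_le_inf_left x hyu⟩
    · rintro _ ⟨u, -, _, rfl, rfl⟩
      exact ⟨_, rfl, inf_le_right⟩
    · rintro _ rfl
      obtain ⟨u, hu, hyu⟩ := hacc.exists_le_uImp (inf_le_right : x ⊓ _ ≤ _)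
      exact ⟨_, ⟨u, hu, _, rfl, rfl⟩, le_inf hyu le_rfl⟩
    · intro u hu
      have h := inf_le_of_mem_uImp hu
      obtain ⟨a, ha, hua⟩ := hacc.exists_le_uImp (h.trans inf_le_left)
      obtain ⟨b, hb, hub⟩ := hacc.exists_le_uImp (h.trans inf_le_right)
      exact ⟨_, ⟨a, ha, b, hb, rfl⟩, le_inf hua hub⟩
    · rintro _ ⟨a, ha, b, hb, rfl⟩
      exact hacc.exists_le_uImp (le_inf
        ((inf_le_inf_left x inf_le_left).trans (inf_le_of_mem_uImp ha))
        ((inf_le_inf_left x inf_le_right).trans (inf_le_of_mem_uImp hb)))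
    · rintro _ ⟨_, rfl, u, -, rfl⟩
      exact ⟨_, rfl, inf_le_left⟩
    · rintro _ rfl
      obtain ⟨u, hu, hxu⟩ := hacc.exists_le_uImp (inf_le_left : y ⊓ _ ≤ y)
      exact ⟨_, ⟨_, rfl, u, hu, rfl⟩, le_inf le_rfl hxu⟩
    · exact hacc.exists_le_uImp ((inf_le_of_mem_uImp hu).trans hyz)
  · rintro ⟨h1, h2, h3, h4, h5, h6⟩ x y
    refine (h1 x y).eq_maxSet_s18 fun z => ⟨fun (hz : x ⊓ z ≤ y) => ?_, ?_⟩
    · obtain ⟨_, ⟨_, -, a, ha, rfl⟩, hza⟩ := (h5 z x).2 z rfl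
      obtain ⟨_, ⟨b, hb, _, -, rfl⟩, hzb⟩ := (h3 x z).2 z rfl
      obtain ⟨c, hc, habc⟩ := (h4 x x z).2 _ ⟨a, ha, b, hb, rfl⟩
      obtain ⟨d, hd, hcd⟩ := h6 x _ _ hz c hc
      exact ⟨d, hd, (le_inf (hza.trans inf_le_right) (hzb.trans inf_le_left)).trans
        (habc.trans hcd)⟩
    · rintro ⟨u, hu, hzu⟩
      obtain ⟨_, rfl, hxu⟩ := (h2 x y).1 _ ⟨x, rfl, u, hu, rfl⟩
      exact (inf_le_inf_left x hzu).trans (hxu.trans inf_le_right)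
end
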